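/- For the 3-server problem on the circle of circumference 2Δ, the work function algorithm is 3-competitive: there exists a constant c, depending only on Δ and the initial configuration X₀ (but not on the number of requests T), such that for every request sequence r_1,…,r_T and every run (X_1,…,X_T) of the WFA, the algorithm's total cost satisfies Σ_{t=1}^T d(X_{t−1},X_t) ≤ 3·OPT + c. -/

import Mathlib

open Finset

/-- Minimum-matching (Wasserstein) distance between two `k`-point configurations,
represented as `k`-tuples of points. -/
noncomputable def confDist {Ω : Type*} [MetricSpace Ω] {k : ℕ} (X Y : Fin k → Ω) : ℝ :=
  ⨅ σ : Equiv.Perm (Fin k), ∑ i, dist (X i) (Y (σ i))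

/-- The work function at time `t` of the `k`-server instance with initial configuration
`X₀` and requests `r 1, r 2, …` (the value `r 0` is unused): the least cost of serving
the first `t` requests and then moving to the configuration `X`. -/
noncomputable def workFn {Ω : Type*} [MetricSpace Ω] (k : ℕ) (X₀ : Fin k → Ω)
    (r : ℕ → Ω) (t : ℕ) (X : Fin k → Ω) : ℝ :=
  sInf { c : ℝ | ∃ Y : ℕ → Fin k → Ω, Y 0 = X₀ ∧
    (∀ i ∈ Finset.Icc 1 t, ∃ j, Y i j = r i) ∧
    c = (∑ i ∈ Finset.Icc 1 t, confDist (Y (i - 1)) (Y i)) + confDist (Y t) X }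

/-- The offline optimum of the `k`-server instance with initial configuration `X₀`
and requests `r 1, …, r T`. -/
noncomputable def opt {Ω : Type*} [MetricSpace Ω] (k : ℕ) (X₀ : Fin k → Ω)
    (r : ℕ → Ω) (T : ℕ) : ℝ :=
  sInf { c : ℝ | ∃ Y : ℕ → Fin k → Ω, Y 0 = X₀ ∧
    (∀ i ∈ Finset.Icc 1 T, ∃ j, Y i j = r i) ∧
    c = ∑ i ∈ Finset.Icc 1 T, confDist (Y (i - 1)) (Y i) }

/-- `OPT_t(Z)`: the least cost of serving the first `t` requests while ending
in the configuration `Z`. -/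
noncomputable def optTo {Ω : Type*} [MetricSpace Ω] (k : ℕ) (X₀ : Fin k → Ω)
    (r : ℕ → Ω) (t : ℕ) (Z : Fin k → Ω) : ℝ :=
  sInf { c : ℝ | ∃ Y : ℕ → Fin k → Ω, Y 0 = X₀ ∧
    (∀ i ∈ Finset.Icc 1 t, ∃ j, Y i j = r i) ∧ Y t = Z ∧
    c = ∑ i ∈ Finset.Icc 1 t, confDist (Y (i - 1)) (Y i) }

/-- `X 0, X 1, …, X T` is a run of the work function algorithm on the `k`-server
instance with initial configuration `X₀` and requests `r 1, …, r T`. -/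
def IsWFARun {Ω : Type*} [MetricSpace Ω] (k : ℕ) (X₀ : Fin k → Ω)
    (r : ℕ → Ω) (T : ℕ) (X : ℕ → Fin k → Ω) : Prop :=
  X 0 = X₀ ∧ ∀ t, 1 ≤ t → t ≤ T →
    (∃ j, X t j = r t) ∧
    ∀ Z : Fin k → Ω, (∃ j, Z j = r t) →
      optTo k X₀ r t (X t) + confDist (X t) (X (t - 1)) ≤
        optTo k X₀ r t Z + confDist Z (X (t - 1))

/-- The properties of a work function on the real line, `2Δ`-periodic and with last request at
`0`, used in the potential argument. -/
structure IsPeriodicWork (Δ : ℝ) (W : ℝ → ℝ → ℝ → ℝ) : Prop where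
  swap₁₂ : ∀ x y z, W x y z = W y x z
  swap₂₃ : ∀ x y z, W x y z = W x z y
  lip : ∀ x x' y z, W x y z ≤ W x' y z + |x - x'|
  periodic : ∀ x y z, W (x + 2 * Δ) y z = W x y z
  exch : ∀ x b c y z, W y c b + W c x z ≤ W x c b + W c y z ∨
    W z c b + W c y x ≤ W x c b + W c y z
  supp : ∀ x y z, |x| ≤ Δ → |y| ≤ Δ → |z| ≤ Δ →
    W 0 y z + |x| ≤ W x y z ∨ W 0 x z + |y| ≤ W x y z ∨ W 0 x y + |z| ≤ W x y z

namespace IsPeriodicWork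

variable {Δ : ℝ} {W : ℝ → ℝ → ℝ → ℝ} (h : IsPeriodicWork Δ W)
include h

theorem swap₁₃ (x y z : ℝ) : W x y z = W z y x := by
  rw [h.swap₁₂, h.swap₂₃, h.swap₁₂]

theorem lip₂ (x y y' z : ℝ) : W x y z ≤ W x y' z + |y - y'| := by
  rw [h.swap₁₂ x y, h.swap₁₂ x y']; exact h.lip ..

/-! Moving one server changes `W 0 · ·` by at most the length of the move. -/

theorem raise_left (i j y : ℝ) (hij : i ≤ j) : W 0 i y ≤ W 0 j y + (j - i) := by
  have := h.lip₂ 0 i j y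
  rwa [abs_sub_comm, abs_of_nonneg (sub_nonneg.2 hij)] at this

theorem raise_right (i j y : ℝ) (hij : i ≤ j) : W 0 y i ≤ W 0 y j + (j - i) := by
  rw [h.swap₂₃ 0 y i, h.swap₂₃ 0 y j]; exact h.raise_left i j y hij

theorem lower_left (i j y : ℝ) (hij : i ≤ j) : W 0 j y ≤ W 0 i y + (j - i) := by
  have := h.lip₂ 0 j i y
  rwa [abs_of_nonneg (sub_nonneg.2 hij)] at this

theorem lower_right (i j y : ℝ) (hij : i ≤ j) : W 0 y j ≤ W 0 y i + (j - i) := by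
  rw [h.swap₂₃ 0 y i, h.swap₂₃ 0 y j]; exact h.lower_left i j y hij

theorem lower_swap (i j y : ℝ) (hij : i ≤ j) : W 0 y j ≤ W 0 i y + (j - i) := by
  rw [h.swap₂₃ 0 y j]; exact h.lower_left i j y hij

theorem wrap_right (s y : ℝ) (hs : 0 ≤ s) : W 0 y Δ ≤ W 0 y (s - Δ) + s := by
  have h1 := h.raise_right (-Δ) (s - Δ) y (by linarith)
  have h2 := h.periodic (-Δ) 0 y
  rw [show -Δ + 2 * Δ = Δ by ring, h.swap₁₃, h.swap₁₂, h.swap₁₃ (-Δ), h.swap₁₂ y] at h2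
  linarith

theorem wrap_left (s y : ℝ) (hs : 0 ≤ s) : W 0 y Δ ≤ W 0 (s - Δ) y + s := by
  rw [h.swap₂₃ 0 (s - Δ)]; exact h.wrap_right s y hs

theorem exch₀ (x u y z : ℝ) : W 0 y u + W 0 x z ≤ W 0 x u + W 0 y z ∨
    W 0 z u + W 0 y x ≤ W 0 x u + W 0 y z := by
  have := h.exch x u 0 y z
  rwa [h.swap₁₂ y 0, h.swap₁₂ x 0, h.swap₁₂ z 0] at this

theorem exch_diag_left (x j k : ℝ) : W 0 x j + W 0 x k ≤ W 0 x x + W 0 j k := by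
  have s1 := h.swap₂₃ 0 j x
  have s2 := h.swap₂₃ 0 k x
  rcases h.exch₀ x x j k with h | h <;> linarith

theorem exch_diag_mid (x j k : ℝ) : W 0 j x + W 0 x k ≤ W 0 x x + W 0 j k := by
  rw [h.swap₂₃ 0 j x]; exact h.exch_diag_left x j k

theorem exch_diag_right (x j k : ℝ) : W 0 j x + W 0 k x ≤ W 0 x x + W 0 j k := by
  rw [h.swap₂₃ 0 k x]; exact h.exch_diag_mid x j k

theorem supp_pos_pos_pos {x y z : ℝ} (hx : 0 ≤ x) (hxy : x ≤ y) (hyz : y ≤ z) (hz : z ≤ Δ) :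
    W 0 y z + x ≤ W x y z := by
  have h1 := h.lower_left x y z hxy
  have h2 := h.lower_swap x z y (hxy.trans hyz)
  have := h.supp x y z
  rw [abs_of_nonneg hx, abs_of_nonneg (by linarith), abs_of_nonneg (by linarith)] at this
  rcases this (by linarith) (by linarith) hz with h | h | h <;> linarith

theorem supp_neg_pos_pos {x y z : ℝ} (hz : -Δ ≤ z) (hz0 : z ≤ 0) (hx : 0 ≤ x) (hxy : x ≤ y)
    (hy : y ≤ Δ) : W 0 z y + x ≤ W x y z ∨ W 0 x y - z ≤ W x y z := by
  have h1 := h.lower_right x y z hxy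
  have s1 := h.swap₂₃ 0 y z
  have s2 := h.swap₂₃ 0 x z
  have := h.supp x y z
  rw [abs_of_nonneg hx, abs_of_nonneg (by linarith), abs_of_nonpos hz0] at this
  rcases this (by linarith) (by linarith) (by linarith) with h | h | h
  · left; linarith
  · left; linarith
  · right; linarith

theorem supp_neg_neg_pos {x y z : ℝ} (hz : -Δ ≤ y) (hyz : y ≤ z) (hz0 : z ≤ 0) (hx : 0 ≤ x)
    (hxΔ : x ≤ Δ) : W 0 y z + x ≤ W x y z ∨ W 0 y x - z ≤ W x y z := by
  have h1 := h.raise_left y z x hyz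
  have s1 := h.swap₂₃ 0 x z
  have s2 := h.swap₂₃ 0 x y
  have := h.supp x y z
  rw [abs_of_nonneg hx, abs_of_nonpos hz0, abs_of_nonpos (by linarith)] at this
  rcases this (by linarith) (by linarith) (by linarith) with h | h | h
  · left; linarith
  · right; linarith
  · right; linarith

theorem supp_neg_diag {x : ℝ} (hx : -Δ ≤ x) (hx0 : x ≤ 0) : W 0 x x - x ≤ W x x x := by
  have := h.supp x x x
  rw [abs_of_nonpos hx0] at this
  rcases this (by linarith) (by linarith) (by linarith) with h | h | h <;> linarith

section
variable {M q a b c : ℝ}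
  (T : ∀ x y z, 0 ≤ x → x ≤ y → y ≤ z → z ≤ Δ →
    M ≤ W 0 x y + W 0 (x - Δ) z + W 0 (y - Δ) (z - Δ) ∧
    M ≤ W 0 y z + W 0 (x - Δ) (y - Δ) + W 0 (z - Δ) x)
include T

theorem even_hexagon_le₁ (hq : 0 ≤ q) (hqa : q ≤ a) (hab : a ≤ b) (hbc : b ≤ c) (hc : c ≤ Δ) :
    M + W 0 Δ Δ + Δ ≤ W (q - Δ) (q - Δ) (q - Δ) + W q a b + W q c (a - Δ) +
      W q (b - Δ) (c - Δ) := by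
  have n0 := h.supp_neg_diag (x := q - Δ) (by linarith) (by linarith)
  have n1 := h.supp_pos_pos_pos hq hqa hab (by linarith)
  rcases h.supp_neg_pos_pos (x := q) (y := c) (z := a - Δ) (by linarith) (by linarith)
    (by linarith) (by linarith) hc with n2 | n2 <;>
  rcases h.supp_neg_neg_pos (x := q) (y := b - Δ) (z := c - Δ) (by linarith) (by linarith)
    (by linarith) (by linarith) (by linarith) with n3 | n3
  · linarith [h.wrap_left q Δ hq, h.wrap_left q (q - Δ) hq, (T a b c (by linarith) hab hbc hc).1]
  · linarith [h.lower_left c Δ Δ hc, h.wrap_left q c hq, h.exch_diag_left (q - Δ) (a - Δ) c,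
      (T q a b hq hqa hab (by linarith)).2]
  · linarith [h.lower_left c Δ Δ hc, h.raise_right (a - Δ) (b - Δ) (q - Δ) (by linarith),
      h.raise_right (b - Δ) (c - Δ) (b - Δ) (by linarith), h.wrap_left q c hq,
      h.exch_diag_left (q - Δ) (b - Δ) c, h.exch_diag_left (b - Δ) q c,
      (T q a b hq hqa hab (by linarith)).2]
  · linarith [h.lower_left a b b hab, h.lower_left b Δ Δ (by linarith), h.lower_right c Δ b hc,
      h.exch_diag_mid b q c, (T q q b hq le_rfl (by linarith) (by linarith)).2]

theorem even_hexagon_le₂ (ha : 0 ≤ a) (haq : a ≤ q) (hqb : q ≤ b) (hbc : b ≤ c) (hc : c ≤ Δ) :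
    M + W 0 Δ Δ + Δ ≤ W (q - Δ) (q - Δ) (q - Δ) + W q a b + W q c (a - Δ) +
      W q (b - Δ) (c - Δ) := by
  have hq : 0 ≤ q := ha.trans haq
  have n0 := h.supp_neg_diag (x := q - Δ) (by linarith) (by linarith)
  have n1 := h.supp_pos_pos_pos ha haq hqb (by linarith)
  rw [h.swap₁₂ a] at n1
  rcases h.supp_neg_pos_pos (x := q) (y := c) (z := a - Δ) (by linarith) (by linarith)
    (by linarith) (by linarith) hc with n2 | n2 <;>
  rcases h.supp_neg_neg_pos (x := q) (y := b - Δ) (z := c - Δ) (by linarith) (by linarith)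
    (by linarith) (by linarith) (by linarith) with n3 | n3
  · linarith [h.wrap_left a Δ ha, h.wrap_right q (a - Δ) hq, h.exch_diag_mid (q - Δ) (a - Δ) c,
      (T q b c (by linarith) hqb hbc hc).1]
  · linarith [h.lower_right c Δ (a - Δ) hc, h.wrap_left a Δ ha,
      (T q q b hq le_rfl hqb (by linarith)).2]
  · linarith [h.lower_right c Δ q hc, h.raise_right (b - Δ) (c - Δ) (b - Δ) (by linarith),
      h.wrap_left b Δ (by linarith), h.exch_diag_left (b - Δ) q Δ,
      (T q q b hq le_rfl hqb (by linarith)).2]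
  · linarith [h.lower_swap q Δ c (by linarith), h.lower_left c Δ Δ hc,
      (T q q b hq le_rfl hqb (by linarith)).2]

theorem even_hexagon_le₃ (ha : 0 ≤ a) (hab : a ≤ b) (hbq : b ≤ q) (hqc : q ≤ c) (hc : c ≤ Δ) :
    M + W 0 Δ Δ + Δ ≤ W (q - Δ) (q - Δ) (q - Δ) + W q a b + W q c (a - Δ) +
      W q (b - Δ) (c - Δ) := by
  have hb : 0 ≤ b := ha.trans hab
  have hq : 0 ≤ q := hb.trans hbq
  have n0 := h.supp_neg_diag (x := q - Δ) (by linarith) (by linarith)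
  have n1 := h.supp_pos_pos_pos ha hab hbq (by linarith)
  rw [h.swap₂₃ a, h.swap₁₂ a] at n1
  rcases h.supp_neg_pos_pos (x := q) (y := c) (z := a - Δ) (by linarith) (by linarith)
    (by linarith) (by linarith) hc with n2 | n2 <;>
  rcases h.supp_neg_neg_pos (x := q) (y := b - Δ) (z := c - Δ) (by linarith) (by linarith)
    (by linarith) (by linarith) (by linarith) with n3 | n3
  · linarith [h.raise_right (b - Δ) (q - Δ) (b - Δ) (by linarith), h.wrap_left a (b - Δ) ha,
      h.wrap_left b Δ hb, h.exch_diag_mid (b - Δ) (a - Δ) c,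
      h.exch_diag_mid (q - Δ) (b - Δ) (c - Δ), (T b q c hb hbq hqc hc).1]
  · linarith [h.lower_left c Δ Δ hc, h.wrap_left a c ha, (T b q q hb hbq le_rfl (by linarith)).1]
  · linarith [h.lower_right c Δ (b - Δ) hc, h.raise_right (b - Δ) (c - Δ) (b - Δ) (by linarith),
      h.wrap_left b Δ hb, h.exch_diag_left (b - Δ) q c, (T b q q hb hbq le_rfl (by linarith)).1]
  · linarith [h.lower_left q Δ Δ (by linarith), h.lower_right c Δ q hc,
      (T b q q hb hbq le_rfl (by linarith)).1]

theorem even_hexagon_le₄ (ha : 0 ≤ a) (hab : a ≤ b) (hbc : b ≤ c) (hcq : c ≤ q) (hq : q ≤ Δ) :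
    M + W 0 Δ Δ + Δ ≤ W (q - Δ) (q - Δ) (q - Δ) + W q a b + W q c (a - Δ) +
      W q (b - Δ) (c - Δ) := by
  have hb : 0 ≤ b := ha.trans hab
  have hq0 : 0 ≤ q := by linarith
  have n0 := h.supp_neg_diag (x := q - Δ) (by linarith) (by linarith)
  have n1 := h.supp_pos_pos_pos ha hab (hbc.trans hcq) hq
  rw [h.swap₂₃ a, h.swap₁₂ a] at n1
  have n2 := h.supp_neg_pos_pos (x := c) (y := q) (z := a - Δ) (by linarith) (by linarith)
    (by linarith) (by linarith) hq
  rw [h.swap₁₂ c] at n2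
  rcases n2 with n2 | n2 <;>
  rcases h.supp_neg_neg_pos (x := q) (y := b - Δ) (z := c - Δ) (by linarith) (by linarith)
    (by linarith) (by linarith) (by linarith) with n3 | n3
  · linarith [h.raise_right (b - Δ) (c - Δ) (b - Δ) (by linarith), h.wrap_left a (b - Δ) ha,
      h.wrap_left b Δ hb, h.exch_diag_mid (b - Δ) (a - Δ) q, (T b q q hb (by linarith) le_rfl hq).1]
  · linarith [h.lower_right q Δ (a - Δ) hq, h.wrap_left a Δ ha,
      (T b q q hb (by linarith) le_rfl hq).1]
  · linarith [h.lower_right q Δ b hq, h.wrap_left q Δ hq0, h.exch_diag_left (q - Δ) b Δ,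
      (T b c q hb hbc hcq hq).2]
  · linarith [h.lower_swap c Δ q (by linarith), h.lower_left q Δ Δ hq,
      (T b q q hb (by linarith) le_rfl hq).1]

theorem odd_hexagon_le₁ (hq : 0 ≤ q) (hqa : q ≤ a) (hab : a ≤ b) (hbc : b ≤ c) (hc : c ≤ Δ) :
    M + W 0 Δ Δ + Δ ≤ W (q - Δ) (q - Δ) (q - Δ) + W q b c + W q (a - Δ) (b - Δ) +
      W q (c - Δ) a := by
  have hb : b ≤ Δ := hbc.trans hc
  have n0 := h.supp_neg_diag (x := q - Δ) (by linarith) (by linarith)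
  have n1 := h.supp_pos_pos_pos hq (hqa.trans hab) hbc hc
  have n3 := h.supp_neg_pos_pos (x := q) (y := a) (z := c - Δ) (by linarith) (by linarith)
    (by linarith) (by linarith) (by linarith)
  rw [h.swap₂₃ q a] at n3
  rcases h.supp_neg_neg_pos (x := q) (y := a - Δ) (z := b - Δ) (by linarith) (by linarith)
    (by linarith) (by linarith) (by linarith) with n2 | n2 <;> rcases n3 with n3 | n3
  · linarith [h.wrap_left q Δ hq, h.wrap_left q (q - Δ) hq, (T a b c (by linarith) hab hbc hc).2]
  · linarith [h.lower_right c Δ b hc, h.wrap_left q Δ hq, h.exch_diag_left (q - Δ) b Δ,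
      (T q a b hq hqa hab hb).1]
  · have s1 := h.swap₂₃ 0 a (a - Δ)
    have s2 := h.swap₂₃ 0 (c - Δ) (a - Δ)
    have s3 := h.swap₂₃ 0 q (a - Δ)
    have s4 := h.swap₂₃ 0 q (c - Δ)
    have s5 := h.swap₂₃ 0 a q
    have s6 := h.swap₂₃ 0 a (c - Δ)
    have m1 := h.lower_left b c c hbc
    have m2 := h.lower_left c Δ Δ hc
    rcases h.exch₀ q (a - Δ) a (c - Δ) with e | e
    · linarith [(T q a c hq hqa (hab.trans hbc) hc).2, h.wrap_left q c hq,
        h.exch_diag_right c (a - Δ) a, h.exch_diag_left (q - Δ) (a - Δ) c]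
    · linarith [(T q q a hq le_rfl hqa (by linarith)).2,
        (T a c c (by linarith) (hab.trans hbc) le_rfl hc).2, h.lower_right c Δ b hc,
        h.lower_swap b c c hbc, h.lower_right c Δ c hc, h.wrap_left q Δ hq,
        h.wrap_right q (q - Δ) hq]
  · linarith [h.lower_swap b Δ c hb, h.lower_left c Δ Δ hc, (T q q a hq le_rfl hqa (by linarith)).2]

theorem odd_hexagon_le₂ (ha : 0 ≤ a) (haq : a ≤ q) (hqb : q ≤ b) (hbc : b ≤ c) (hc : c ≤ Δ) :
    M + W 0 Δ Δ + Δ ≤ W (q - Δ) (q - Δ) (q - Δ) + W q b c + W q (a - Δ) (b - Δ) +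
      W q (c - Δ) a := by
  have hq : 0 ≤ q := ha.trans haq
  have n0 := h.supp_neg_diag (x := q - Δ) (by linarith) (by linarith)
  have n1 := h.supp_pos_pos_pos hq hqb hbc hc
  have n3 := h.supp_neg_pos_pos (x := a) (y := q) (z := c - Δ) (by linarith) (by linarith)
    (by linarith) (by linarith) (by linarith)
  rw [h.swap₁₂ a, h.swap₂₃ q a] at n3
  rcases h.supp_neg_neg_pos (x := q) (y := a - Δ) (z := b - Δ) (by linarith) (by linarith)
    (by linarith) (by linarith) (by linarith) with n2 | n2 <;> rcases n3 with n3 | n3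
  · linarith [h.wrap_left a Δ ha, h.wrap_right q (a - Δ) hq,
      h.exch_diag_mid (q - Δ) (a - Δ) (b - Δ), (T q b c hq hqb hbc hc).2]
  · linarith [h.lower_right c Δ b hc, h.raise_right (a - Δ) (q - Δ) (a - Δ) (by linarith),
      h.wrap_left a Δ ha, h.exch_diag_left (a - Δ) b Δ, h.exch_diag_mid (q - Δ) (a - Δ) (b - Δ),
      (T a q b ha haq hqb (by linarith)).1]
  · linarith [h.lower_left b c c hbc, h.lower_right c Δ (a - Δ) hc, h.wrap_left a Δ ha,
      h.exch_diag_right c (a - Δ) q, (T q q c hq le_rfl (by linarith) hc).2]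
  · linarith [h.lower_left b Δ Δ (by linarith), h.lower_right c Δ b hc,
      (T a q q ha haq le_rfl (by linarith)).1]

theorem odd_hexagon_le₃ (ha : 0 ≤ a) (hab : a ≤ b) (hbq : b ≤ q) (hqc : q ≤ c) (hc : c ≤ Δ) :
    M + W 0 Δ Δ + Δ ≤ W (q - Δ) (q - Δ) (q - Δ) + W q b c + W q (a - Δ) (b - Δ) +
      W q (c - Δ) a := by
  have hb : 0 ≤ b := ha.trans hab
  have hq : 0 ≤ q := hb.trans hbq
  have n0 := h.supp_neg_diag (x := q - Δ) (by linarith) (by linarith)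
  have n1 := h.supp_pos_pos_pos hb hbq hqc hc
  rw [h.swap₁₂ b] at n1
  have n3 := h.supp_neg_pos_pos (x := a) (y := q) (z := c - Δ) (by linarith) (by linarith)
    (by linarith) (by linarith) (by linarith)
  rw [h.swap₁₂ a, h.swap₂₃ q a] at n3
  rcases h.supp_neg_neg_pos (x := q) (y := a - Δ) (z := b - Δ) (by linarith) (by linarith)
    (by linarith) (by linarith) (by linarith) with n2 | n2 <;> rcases n3 with n3 | n3
  · linarith [h.wrap_left a (b - Δ) ha, h.wrap_left b Δ hb, (T q q c hq le_rfl hqc hc).2]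
  · linarith [h.lower_right c Δ q hc, h.raise_right (a - Δ) (b - Δ) (a - Δ) (by linarith),
      h.wrap_left a Δ ha, h.exch_diag_left (a - Δ) q Δ,
      (T a q q ha (by linarith) le_rfl (by linarith)).1]
  · linarith [h.lower_left q Δ Δ (by linarith), h.wrap_left a q ha, (T q q c hq le_rfl hqc hc).2]
  · linarith [h.lower_left q Δ Δ (by linarith), h.lower_right c Δ q hc,
      (T a q q ha (by linarith) le_rfl (by linarith)).1]

theorem odd_hexagon_le₄ (ha : 0 ≤ a) (hab : a ≤ b) (hbc : b ≤ c) (hcq : c ≤ q) (hq : q ≤ Δ) :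
    M + W 0 Δ Δ + Δ ≤ W (q - Δ) (q - Δ) (q - Δ) + W q b c + W q (a - Δ) (b - Δ) +
      W q (c - Δ) a := by
  have hb : 0 ≤ b := ha.trans hab
  have hc : 0 ≤ c := hb.trans hbc
  have n0 := h.supp_neg_diag (x := q - Δ) (by linarith) (by linarith)
  have n1 := h.supp_pos_pos_pos hb hbc hcq hq
  rw [h.swap₂₃ b, h.swap₁₂ b] at n1
  have n3 := h.supp_neg_pos_pos (x := a) (y := q) (z := c - Δ) (by linarith) (by linarith)
    (by linarith) (by linarith) (by linarith)
  rw [h.swap₁₂ a, h.swap₂₃ q a] at n3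
  rcases h.supp_neg_neg_pos (x := q) (y := a - Δ) (z := b - Δ) (by linarith) (by linarith)
    (by linarith) (by linarith) (by linarith) with n2 | n2 <;> rcases n3 with n3 | n3
  · linarith [h.wrap_left a Δ ha, h.wrap_right b (a - Δ) hb, (T c q q hc hcq le_rfl hq).1]
  · linarith [h.lower_left a b q hab, h.lower_left c q q hcq, h.lower_left q Δ Δ hq,
      h.wrap_left a (b - Δ) ha, h.exch_diag_mid q (b - Δ) Δ, (T b q q hb (by linarith) le_rfl hq).1]
  · linarith [h.lower_left q Δ Δ hq, h.wrap_left a q ha, (T c q q hc hcq le_rfl hq).1]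
  · linarith [h.lower_left c Δ Δ (by linarith), h.lower_right q Δ c hq,
      (T a q q ha (by linarith) le_rfl hq).1]

end

theorem periodic_int (n : ℤ) (x y z : ℝ) : W (x + n * (2 * Δ)) y z = W x y z :=
  (show Function.Periodic (fun x => W x y z) (2 * Δ) from fun x => h.periodic x y z).int_mul n x

theorem periodic_int₂ (n : ℤ) (x y z : ℝ) : W x (y + n * (2 * Δ)) z = W x y z := by
  rw [h.swap₁₂, h.periodic_int, h.swap₁₂]

theorem periodic_int₃ (n : ℤ) (x y z : ℝ) : W x y (z + n * (2 * Δ)) = W x y z := by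
  rw [h.swap₂₃, h.periodic_int₂, h.swap₂₃]

theorem congr_add (k m n : ℤ) {x y z x' y' z' : ℝ} (hx : x' = x + k * (2 * Δ))
    (hy : y' = y + m * (2 * Δ)) (hz : z' = z + n * (2 * Δ)) : W x' y' z' = W x y z := by
  rw [hx, hy, hz, h.periodic_int, h.periodic_int₂, h.periodic_int₃]

theorem reflect : IsPeriodicWork Δ fun x y z => W (-x) (-y) (-z) where
  swap₁₂ _ _ _ := h.swap₁₂ ..
  swap₂₃ _ _ _ := h.swap₂₃ ..
  lip x x' y z := by
    have := h.lip (-x) (-x') (-y) (-z)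
    rwa [← neg_sub', abs_neg] at this
  periodic x y z := h.congr_add (-1) 0 0 (by push_cast; ring) (by simp) (by simp)
  exch _ _ _ _ _ := h.exch ..
  supp x y z hx hy hz := by
    simpa using h.supp (-x) (-y) (-z) (by simpa) (by simpa) (by simpa)

end IsPeriodicWork

/-- The sum of `W q · ·` over three alternate sides of the centrally symmetric hexagon
inscribed in the circle and having `a`, `b`, `c` as three consecutive vertices. -/
def hexagonSum (Δ : ℝ) (W : ℝ → ℝ → ℝ → ℝ) (q a b c : ℝ) : ℝ :=
  W q a b + W q c (a + Δ) + W q (b + Δ) (c + Δ)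

namespace IsPeriodicWork

variable {Δ : ℝ} {W : ℝ → ℝ → ℝ → ℝ} (h : IsPeriodicWork Δ W)
include h

theorem hexagonSum_congr (n : ℤ) {q a b c a' b' c' : ℝ} (ha : a' = a + n * (2 * Δ))
    (hb : b' = b + n * (2 * Δ)) (hc : c' = c + n * (2 * Δ)) :
    hexagonSum Δ W q a' b' c' = hexagonSum Δ W q a b c := by
  subst ha hb hc
  unfold hexagonSum
  congr 1
  · congr 1
    · exact h.congr_add 0 n n (by simp) rfl rfl
    · exact h.congr_add 0 n n (by simp) rfl (by ring)
  · exact h.congr_add 0 n n (by simp) (by ring) (by ring)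

theorem hexagonSum_eq_even (q a b c : ℝ) :
    hexagonSum Δ W q a b c = W q a b + W q c (a - Δ) + W q (b - Δ) (c - Δ) := by
  unfold hexagonSum
  congr 1
  · congr 1
    exact h.congr_add 0 0 1 (by simp) (by simp) (by push_cast; ring)
  · exact h.congr_add 0 1 1 (by simp) (by push_cast; ring) (by push_cast; ring)

theorem hexagonSum_add_eq_odd (q a b c : ℝ) :
    hexagonSum Δ W q (a + Δ) (b + Δ) (c + Δ) =
      W q b c + W q (a - Δ) (b - Δ) + W q (c - Δ) a := by
  have e1 : W q (a + Δ) (b + Δ) = W q (a - Δ) (b - Δ) :=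
    h.congr_add 0 1 1 (by simp) (by push_cast; ring) (by push_cast; ring)
  have e2 : W q (c + Δ) (a + Δ + Δ) = W q (c - Δ) a :=
    h.congr_add 0 1 1 (by simp) (by push_cast; ring) (by push_cast; ring)
  have e3 : W q (b + Δ + Δ) (c + Δ + Δ) = W q b c :=
    h.congr_add 0 1 1 (by simp) (by push_cast; ring) (by push_cast; ring)
  unfold hexagonSum
  linarith

theorem hexagonSum_rotate (q a b c : ℝ) :
    hexagonSum Δ W q b c (a + Δ) = hexagonSum Δ W q (a + Δ) (b + Δ) (c + Δ) := by
  have e : W q (c + Δ) (a + Δ + Δ) = W q (c + Δ) a :=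
    h.congr_add 0 0 1 (by simp) (by simp) (by push_cast; ring)
  have e' : W q (b + Δ + Δ) (c + Δ + Δ) = W q b c :=
    h.congr_add 0 1 1 (by simp) (by push_cast; ring) (by push_cast; ring)
  have s := h.swap₂₃ q (a + Δ) (b + Δ)
  unfold hexagonSum
  linarith

section
variable {M : ℝ} (T : ∀ a b c, a ≤ b → b ≤ c → c ≤ a + Δ → M ≤ hexagonSum Δ W 0 a b c)
include T

theorem hexagonSum_bounds (x y z : ℝ) (hxy : x ≤ y) (hyz : y ≤ z) (hz : z ≤ x + Δ) :
    M ≤ W 0 x y + W 0 (x - Δ) z + W 0 (y - Δ) (z - Δ) ∧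
    M ≤ W 0 y z + W 0 (x - Δ) (y - Δ) + W 0 (z - Δ) x := by
  rw [h.swap₂₃ 0 (x - Δ) z, ← h.hexagonSum_eq_even, ← h.hexagonSum_add_eq_odd]
  exact ⟨T _ _ _ hxy hyz hz, T _ _ _ (by linarith) (by linarith) (by linarith)⟩

theorem hexagon_le_of_mem_Icc {q a b c : ℝ} (hq : 0 ≤ q) (hqΔ : q ≤ Δ) (ha : 0 ≤ a)
    (hab : a ≤ b) (hbc : b ≤ c) (hc : c ≤ Δ) :
    M + W 0 Δ Δ + Δ ≤ W (q - Δ) (q - Δ) (q - Δ) + hexagonSum Δ W q a b c ∧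
    M + W 0 Δ Δ + Δ ≤ W (q - Δ) (q - Δ) (q - Δ) +
      hexagonSum Δ W q (a + Δ) (b + Δ) (c + Δ) := by
  have T' := fun x y z (hx : 0 ≤ x) hxy hyz (hz : z ≤ Δ) =>
    h.hexagonSum_bounds T x y z hxy hyz (by linarith)
  rw [h.hexagonSum_eq_even, h.hexagonSum_add_eq_odd, ← add_assoc, ← add_assoc, ← add_assoc,
    ← add_assoc]
  rcases le_total q a with hqa | hqa
  · exact ⟨h.even_hexagon_le₁ T' hq hqa hab hbc hc, h.odd_hexagon_le₁ T' hq hqa hab hbc hc⟩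
  rcases le_total q b with hqb | hqb
  · exact ⟨h.even_hexagon_le₂ T' ha hqa hqb hbc hc, h.odd_hexagon_le₂ T' ha hqa hqb hbc hc⟩
  rcases le_total q c with hqc | hqc
  · exact ⟨h.even_hexagon_le₃ T' ha hab hqb hqc hc, h.odd_hexagon_le₃ T' ha hab hqb hqc hc⟩
  · exact ⟨h.even_hexagon_le₄ T' ha hab hbc hqc hqΔ, h.odd_hexagon_le₄ T' ha hab hbc hqc hqΔ⟩

theorem hexagon_le_of_nonneg_of_le {q a b c : ℝ} (hq : 0 ≤ q) (hqΔ : q ≤ Δ) (ha : 0 ≤ a)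
    (haΔ : a ≤ Δ) (hab : a ≤ b) (hbc : b ≤ c) (hc : c ≤ a + Δ) :
    M + W 0 Δ Δ + Δ ≤ W (q - Δ) (q - Δ) (q - Δ) + hexagonSum Δ W q a b c ∧
    M + W 0 Δ Δ + Δ ≤ W (q - Δ) (q - Δ) (q - Δ) +
      hexagonSum Δ W q (a + Δ) (b + Δ) (c + Δ) := by
  rcases le_total c Δ with hcΔ | hcΔ
  · exact h.hexagon_le_of_mem_Icc T hq hqΔ ha hab hbc hcΔ
  have shift (x y z : ℝ) : hexagonSum Δ W q (x + Δ + Δ) (y + Δ + Δ) (z + Δ + Δ) =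
      hexagonSum Δ W q x y z :=
    h.hexagonSum_congr 1 (by push_cast; ring) (by push_cast; ring) (by push_cast; ring)
  rcases le_total b Δ with hbΔ | hbΔ
  · have := h.hexagon_le_of_mem_Icc T (a := c - Δ) (b := a) (c := b) hq hqΔ (by linarith)
      (by linarith) hab hbΔ
    have e1 := h.hexagonSum_rotate q (c - Δ) a b
    have e2 := h.hexagonSum_rotate q (c - Δ + Δ) (a + Δ) (b + Δ)
    rw [shift, sub_add_cancel] at e2
    rw [sub_add_cancel] at e1 this
    rw [e1, e2]
    exact this.symm
  · have := h.hexagon_le_of_mem_Icc T (a := b - Δ) (b := c - Δ) (c := a) hq hqΔ (by linarith)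
      (by linarith) (by linarith) haΔ
    have e1 := h.hexagonSum_rotate q (c - Δ) a b
    have e2 := h.hexagonSum_rotate q b c (a + Δ)
    have e3 := shift (b - Δ) (c - Δ) a
    simp only [sub_add_cancel] at e1 e3 this
    rw [e1, e2, e3, ← h.hexagonSum_rotate q a b c]
    exact this

theorem hexagon_le_of_nonneg (hΔ : 0 < Δ) {q a b c : ℝ} (hq : 0 ≤ q) (hqΔ : q ≤ Δ)
    (hab : a ≤ b) (hbc : b ≤ c) (hc : c ≤ a + Δ) :
    M + W 0 Δ Δ + Δ ≤ W (q - Δ) (q - Δ) (q - Δ) + hexagonSum Δ W q a b c := by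
  have hΔ2 : 0 < 2 * Δ := by linarith
  set n := ⌊a / (2 * Δ)⌋ with hn
  have h1 : n * (2 * Δ) ≤ a := (le_div_iff₀ hΔ2).1 (Int.floor_le _)
  have h2 : a < (n + 1) * (2 * Δ) := (div_lt_iff₀ hΔ2).1 (Int.lt_floor_add_one _)
  rcases le_total (a - n * (2 * Δ)) Δ with h3 | h3
  · rw [h.hexagonSum_congr n (a := a - n * (2 * Δ)) (b := b - n * (2 * Δ))
      (c := c - n * (2 * Δ)) (by ring) (by ring) (by ring)]
    exact (h.hexagon_le_of_nonneg_of_le T hq hqΔ (by linarith) h3 (by linarith) (by linarith)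
      (by linarith)).1
  · rw [h.hexagonSum_congr n (a := a - n * (2 * Δ) - Δ + Δ) (b := b - n * (2 * Δ) - Δ + Δ)
      (c := c - n * (2 * Δ) - Δ + Δ) (by ring) (by ring) (by ring)]
    exact (h.hexagon_le_of_nonneg_of_le T hq hqΔ (by linarith) (by linarith) (by linarith)
      (by linarith) (by linarith)).2

end

theorem hexagonSum_reflect (q a b c : ℝ) :
    hexagonSum Δ (fun x y z => W (-x) (-y) (-z)) q a b c =
      hexagonSum Δ W (-q) (-c - Δ) (-b - Δ) (-a - Δ) := by
  unfold hexagonSum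
  simp only [neg_add', sub_add_cancel]
  rw [h.swap₂₃ (-q) (-a), h.swap₂₃ (-q) (-c), h.swap₂₃ (-q) (-b - Δ)]
  ring

theorem hexagon_le (hΔ : 0 < Δ) {M : ℝ}
    (T : ∀ a b c, a ≤ b → b ≤ c → c ≤ a + Δ → M ≤ hexagonSum Δ W 0 a b c)
    (q a b c : ℝ) (hab : a ≤ b) (hbc : b ≤ c) (hc : c ≤ a + Δ) :
    M + W 0 Δ Δ + Δ ≤ W (q + Δ) (q + Δ) (q + Δ) + hexagonSum Δ W q a b c := by
  have hΔ2 : 0 < 2 * Δ := by linarith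
  set n := ⌊q / (2 * Δ)⌋ with hn
  have h1 : n * (2 * Δ) ≤ q := (le_div_iff₀ hΔ2).1 (Int.floor_le _)
  have h2 : q < (n + 1) * (2 * Δ) := (div_lt_iff₀ hΔ2).1 (Int.lt_floor_add_one _)
  have shift (m : ℤ) : hexagonSum Δ W q a b c = hexagonSum Δ W (q - m * (2 * Δ)) a b c := by
    unfold hexagonSum
    rw [← h.periodic_int m (q - m * (2 * Δ)), ← h.periodic_int m (q - m * (2 * Δ)),
      ← h.periodic_int m (q - m * (2 * Δ)), sub_add_cancel]
  rcases le_total (q - n * (2 * Δ)) Δ with h3 | h3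
  · have := h.hexagon_le_of_nonneg T hΔ (q := q - n * (2 * Δ)) (by linarith) h3 hab hbc hc
    rwa [← shift, ← h.congr_add (n + 1) (n + 1) (n + 1) (x := q - n * (2 * Δ) - Δ)
      (x' := q + Δ) (y' := q + Δ) (z' := q + Δ)] at this <;> push_cast <;> ring
  · have T' : ∀ a b c, a ≤ b → b ≤ c → c ≤ a + Δ →
        M ≤ hexagonSum Δ (fun x y z => W (-x) (-y) (-z)) 0 a b c := by
      intro a b c hab hbc hc
      rw [h.hexagonSum_reflect, neg_zero]
      exact T _ _ _ (by linarith) (by linarith) (by linarith)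
    have := h.reflect.hexagon_le_of_nonneg T' hΔ (q := -(q - (n + 1 : ℤ) * (2 * Δ)))
      (a := -c - Δ) (b := -b - Δ) (c := -a - Δ) (by push_cast; linarith)
      (by push_cast; linarith) (by linarith) (by linarith) (by linarith)
    rw [h.hexagonSum_reflect, neg_neg, show -(-a - Δ) - Δ = a by ring,
      show -(-b - Δ) - Δ = b by ring, show -(-c - Δ) - Δ = c by ring, ← shift] at this
    have e1 : W (q + Δ) (q + Δ) (q + Δ) = W (-(-(q - (n + 1 : ℤ) * (2 * Δ)) - Δ))
        (-(-(q - (n + 1 : ℤ) * (2 * Δ)) - Δ)) (-(-(q - (n + 1 : ℤ) * (2 * Δ)) - Δ)) :=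
      h.congr_add (n + 1) (n + 1) (n + 1) (by ring) (by ring) (by ring)
    have e2 : W 0 Δ Δ = W (-0) (-Δ) (-Δ) :=
      h.congr_add 0 1 1 (by simp) (by push_cast; ring) (by push_cast; ring)
    rw [e1, e2]
    exact this

end IsPeriodicWork

section confDist

variable {Ω : Type*} [MetricSpace Ω]

theorem confDist_nonneg {k : ℕ} (X Y : Fin k → Ω) : 0 ≤ confDist X Y :=
  Real.iInf_nonneg fun _ => sum_nonneg fun _ _ => dist_nonneg

theorem confDist_le {k : ℕ} (X Y : Fin k → Ω) (σ : Equiv.Perm (Fin k)) :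
    confDist X Y ≤ ∑ i, dist (X i) (Y (σ i)) :=
  ciInf_le (Set.finite_range _).bddBelow σ

theorem exists_confDist_eq {k : ℕ} (X Y : Fin k → Ω) :
    ∃ σ : Equiv.Perm (Fin k), confDist X Y = ∑ i, dist (X i) (Y (σ i)) := by
  obtain ⟨σ, hσ⟩ := exists_eq_ciInf_of_finite
    (f := fun σ : Equiv.Perm (Fin k) => ∑ i, dist (X i) (Y (σ i)))
  exact ⟨σ, hσ.symm⟩

theorem confDist_comm {k : ℕ} (X Y : Fin k → Ω) : confDist X Y = confDist Y X := by
  have key (X Y : Fin k → Ω) : confDist X Y ≤ confDist Y X := by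
    obtain ⟨σ, hσ⟩ := exists_confDist_eq Y X
    refine (confDist_le X Y σ.symm).trans_eq ?_
    rw [hσ, ← Equiv.sum_comp σ]
    simp [dist_comm]
  exact le_antisymm (key X Y) (key Y X)

theorem confDist_self {k : ℕ} (X : Fin k → Ω) : confDist X X = 0 :=
  le_antisymm ((confDist_le X X 1).trans_eq (by simp)) (confDist_nonneg X X)

theorem confDist_update_le {k : ℕ} (X : Fin k → Ω) (i : Fin k) (p : Ω) :
    confDist (Function.update X i p) X ≤ dist (X i) p := by
  refine (confDist_le _ X 1).trans_eq ?_
  rw [Finset.sum_eq_single i (by simp +contextual [Function.update_of_ne]) (by simp)]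
  simp [dist_comm]

theorem perm_fin_three_cases (σ : Equiv.Perm (Fin 3)) :
    (σ 0 = 0 ∧ σ 1 = 1 ∧ σ 2 = 2) ∨ (σ 0 = 0 ∧ σ 1 = 2 ∧ σ 2 = 1) ∨
    (σ 0 = 1 ∧ σ 1 = 0 ∧ σ 2 = 2) ∨ (σ 0 = 1 ∧ σ 1 = 2 ∧ σ 2 = 0) ∨
    (σ 0 = 2 ∧ σ 1 = 0 ∧ σ 2 = 1) ∨ (σ 0 = 2 ∧ σ 1 = 1 ∧ σ 2 = 0) := by
  revert σ; decide

end confDist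

/-- The least cost of assigning three tasks `x`, `y`, `z` bijectively to three agents with
cost functions `α`, `β`, `γ`. -/
noncomputable def assignCost {Ω : Type*} (α β γ : Ω → ℝ) (x y z : Ω) : ℝ :=
  min (min (min (α x + β y + γ z) (α x + β z + γ y)) (min (α y + β x + γ z) (α y + β z + γ x)))
    (min (α z + β x + γ y) (α z + β y + γ x))

section assignCost

variable {Ω : Type*} (α β γ : Ω → ℝ)

theorem assignCost_cases (x y z : Ω) :
    assignCost α β γ x y z = α x + β y + γ z ∨ assignCost α β γ x y z = α x + β z + γ y ∨
    assignCost α β γ x y z = α y + β x + γ z ∨ assignCost α β γ x y z = α y + β z + γ x ∨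
    assignCost α β γ x y z = α z + β x + γ y ∨ assignCost α β γ x y z = α z + β y + γ x := by
  unfold assignCost
  grind

theorem assignCost_le (x y z : Ω) :
    assignCost α β γ x y z ≤ α x + β y + γ z ∧ assignCost α β γ x y z ≤ α x + β z + γ y ∧
    assignCost α β γ x y z ≤ α y + β x + γ z ∧ assignCost α β γ x y z ≤ α y + β z + γ x ∧
    assignCost α β γ x y z ≤ α z + β x + γ y ∧ assignCost α β γ x y z ≤ α z + β y + γ x := by
  simp [assignCost]

end assignCost

theorem confDist_eq_assignCost {Ω : Type*} [MetricSpace Ω] (X Y : Fin 3 → Ω) :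
    confDist X Y = assignCost (dist (X 0)) (dist (X 1)) (dist (X 2)) (Y 0) (Y 1) (Y 2) := by
  apply le_antisymm
  · have key (i j k : Fin 3) (h : Function.Bijective ![i, j, k]) :
        confDist X Y ≤ dist (X 0) (Y i) + dist (X 1) (Y j) + dist (X 2) (Y k) :=
      (confDist_le X Y (Equiv.ofBijective _ h)).trans_eq (by simp [Fin.sum_univ_three])
    unfold assignCost
    refine le_min (le_min (le_min ?_ ?_) (le_min ?_ ?_)) (le_min ?_ ?_) <;>
      exact key _ _ _ (by decide)
  · obtain ⟨σ, hσ⟩ := exists_confDist_eq X Y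
    rw [hσ, Fin.sum_univ_three]
    obtain ⟨h1, h2, h3, h4, h5, h6⟩ := assignCost_le (dist (X 0)) (dist (X 1)) (dist (X 2))
      (Y 0) (Y 1) (Y 2)
    rcases perm_fin_three_cases σ with h | h | h | h | h | h <;>
      obtain ⟨e0, e1, e2⟩ := h <;> rw [e0, e1, e2] <;> assumption

/-- The properties of a `3`-server work function used by the analysis: symmetry, the Lipschitz
property and two exchange properties. -/
structure IsWorkLike {Ω : Type*} [MetricSpace Ω] (w : Ω → Ω → Ω → ℝ) : Prop where
  swap₁₂ : ∀ x y z, w x y z = w y x z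
  swap₂₃ : ∀ x y z, w x y z = w x z y
  lip : ∀ x x' y z, w x y z ≤ w x' y z + dist x x'
  exch₂ : ∀ x b c y z, w y c b + w c x z ≤ w x c b + w c y z ∨
    w z c b + w c y x ≤ w x c b + w c y z
  exch₃ : ∀ x a b y₁ y₂ y₃, w y₁ a b + w x y₂ y₃ ≤ w x a b + w y₁ y₂ y₃ ∨
    w y₂ a b + w y₁ x y₃ ≤ w x a b + w y₁ y₂ y₃ ∨
    w y₃ a b + w y₁ y₂ x ≤ w x a b + w y₁ y₂ y₃

theorem isWorkLike_assignCost {Ω : Type*} [MetricSpace Ω] (p q s : Ω) :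
    IsWorkLike (assignCost (dist p) (dist q) (dist s)) where
  swap₁₂ x y z := by unfold assignCost; grind
  swap₂₃ x y z := by unfold assignCost; grind
  lip x x' y z := by
    have t1 := dist_triangle p x' x
    have t2 := dist_triangle q x' x
    have t3 := dist_triangle s x' x
    rw [dist_comm x' x] at t1 t2 t3
    obtain ⟨h1, h2, h3, h4, h5, h6⟩ := assignCost_le (dist p) (dist q) (dist s) x y z
    rcases assignCost_cases (dist p) (dist q) (dist s) x' y z with h | h | h | h | h | h <;>
      linarith
  exch₂ x b c y z := by
    obtain ⟨h1, h2, h3, h4, h5, h6⟩ := assignCost_le (dist p) (dist q) (dist s) y c b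
    obtain ⟨i1, i2, i3, i4, i5, i6⟩ := assignCost_le (dist p) (dist q) (dist s) c x z
    obtain ⟨j1, j2, j3, j4, j5, j6⟩ := assignCost_le (dist p) (dist q) (dist s) z c b
    obtain ⟨k1, k2, k3, k4, k5, k6⟩ := assignCost_le (dist p) (dist q) (dist s) c y x
    rcases assignCost_cases (dist p) (dist q) (dist s) x c b with h | h | h | h | h | h <;>
    rcases assignCost_cases (dist p) (dist q) (dist s) c y z with h' | h' | h' | h' | h' | h' <;>
    first
    | left; linarith
    | right; linarith
  exch₃ x a b y₁ y₂ y₃ := by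
    obtain ⟨h1, h2, h3, h4, h5, h6⟩ := assignCost_le (dist p) (dist q) (dist s) y₁ a b
    obtain ⟨i1, i2, i3, i4, i5, i6⟩ := assignCost_le (dist p) (dist q) (dist s) x y₂ y₃
    obtain ⟨j1, j2, j3, j4, j5, j6⟩ := assignCost_le (dist p) (dist q) (dist s) y₂ a b
    obtain ⟨k1, k2, k3, k4, k5, k6⟩ := assignCost_le (dist p) (dist q) (dist s) y₁ x y₃
    obtain ⟨l1, l2, l3, l4, l5, l6⟩ := assignCost_le (dist p) (dist q) (dist s) y₃ a b
    obtain ⟨m1, m2, m3, m4, m5, m6⟩ := assignCost_le (dist p) (dist q) (dist s) y₁ y₂ x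
    rcases assignCost_cases (dist p) (dist q) (dist s) x a b with h | h | h | h | h | h <;>
    rcases assignCost_cases (dist p) (dist q) (dist s) y₁ y₂ y₃ with
      h' | h' | h' | h' | h' | h' <;>
    first
    | left; linarith
    | right; left; linarith
    | right; right; linarith

/-- The update of a `3`-server work function by a request at `r`. -/
noncomputable def workUpdate {Ω : Type*} [MetricSpace Ω] (w : Ω → Ω → Ω → ℝ) (r x y z : Ω) : ℝ :=
  min (min (w r y z + dist x r) (w r x z + dist y r)) (w r x y + dist z r)

section workUpdate

variable {Ω : Type*} [MetricSpace Ω] {w : Ω → Ω → Ω → ℝ}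

theorem workUpdate_cases (w : Ω → Ω → Ω → ℝ) (r x y z : Ω) :
    workUpdate w r x y z = w r y z + dist x r ∨ workUpdate w r x y z = w r x z + dist y r ∨
    workUpdate w r x y z = w r x y + dist z r := by
  unfold workUpdate
  grind

theorem workUpdate_le (w : Ω → Ω → Ω → ℝ) (r x y z : Ω) :
    workUpdate w r x y z ≤ w r y z + dist x r ∧ workUpdate w r x y z ≤ w r x z + dist y r ∧
    workUpdate w r x y z ≤ w r x y + dist z r := by
  simp [workUpdate]

theorem workUpdate_self_le (w : Ω → Ω → Ω → ℝ) (r y z : Ω) :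
    workUpdate w r r y z ≤ w r y z := by
  simpa using (workUpdate_le w r r y z).1

namespace IsWorkLike

theorem lip₂ (h : IsWorkLike w) (x y y' z : Ω) : w x y z ≤ w x y' z + dist y y' := by
  rw [h.swap₁₂ x y, h.swap₁₂ x y']; exact h.lip ..

theorem lip₃ (h : IsWorkLike w) (x y z z' : Ω) : w x y z ≤ w x y z' + dist z z' := by
  rw [h.swap₂₃ x y, h.swap₂₃ x y]; exact h.lip₂ ..

theorem lip_all (h : IsWorkLike w) (x y z x' y' z' : Ω) :
    w x y z ≤ w x' y' z' + (dist x x' + dist y y' + dist z z') := by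
  linarith [h.lip x x' y z, h.lip₂ x' y y' z, h.lip₃ x' y' z z']

theorem le_workUpdate (h : IsWorkLike w) (r x y z : Ω) : w x y z ≤ workUpdate w r x y z := by
  have h1 := h.lip x r y z
  have h2 := h.lip₂ x y r z
  have h3 := h.lip₃ x y z r
  rw [h.swap₁₂ x r] at h2
  rw [h.swap₂₃ x y r, h.swap₁₂ x r] at h3
  rcases workUpdate_cases w r x y z with e | e | e <;> linarith

theorem exch₂' (h : IsWorkLike w) (r x b y z : Ω) :
    w r y b + w r x z ≤ w r x b + w r y z ∨ w r z b + w r y x ≤ w r x b + w r y z := by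
  have := h.exch₂ x b r y z
  rwa [h.swap₁₂ y r, h.swap₁₂ x r b, h.swap₁₂ z r] at this

theorem workUpdate (h : IsWorkLike w) (r : Ω) : IsWorkLike (workUpdate w r) where
  swap₁₂ x y z := by
    have s := h.swap₂₃ r x y
    unfold _root_.workUpdate; grind
  swap₂₃ x y z := by
    have s := h.swap₂₃ r y z
    unfold _root_.workUpdate; grind
  lip x x' y z := by
    obtain ⟨h1, h2, h3⟩ := workUpdate_le w r x y z
    rcases workUpdate_cases w r x' y z with e | e | e
    · linarith [dist_triangle x x' r]
    · linarith [h.lip₂ r x x' z]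
    · linarith [h.lip₂ r x x' y]
  exch₂ x b c y z := by
    obtain ⟨h1, h2, h3⟩ := workUpdate_le w r y c b
    obtain ⟨i1, i2, i3⟩ := workUpdate_le w r c x z
    obtain ⟨j1, j2, j3⟩ := workUpdate_le w r z c b
    obtain ⟨k1, k2, k3⟩ := workUpdate_le w r c y x
    have s := h.swap₂₃ r
    rcases workUpdate_cases w r x c b with e | e | e <;>
    rcases workUpdate_cases w r c y z with e' | e' | e'
    · rcases h.exch₂' r c b y z with f | f
      · left; linarith
      · right; linarith [s y c]
    · left; linarith
    · right; linarith
    · rcases h.exch₂' r x b y z with f | f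
      · left; linarith
      · right; linarith
    · rcases h.exch₂' r x b c z with f | f
      · left; linarith
      · right; linarith
    · rcases h.exch₂' r x b c y with f | f
      · right; linarith [s x y]
      · left; linarith
    · rcases h.exch₂' r x c y z with f | f
      · left; linarith
      · right; linarith
    · right; linarith [s c z, s c x]
    · left; linarith [s c y, s c x]
  exch₃ x a b y₁ y₂ y₃ := by
    obtain ⟨h1, h2, h3⟩ := workUpdate_le w r y₁ a b
    obtain ⟨i1, i2, i3⟩ := workUpdate_le w r x y₂ y₃
    obtain ⟨j1, j2, j3⟩ := workUpdate_le w r y₂ a b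
    obtain ⟨k1, k2, k3⟩ := workUpdate_le w r y₁ x y₃
    obtain ⟨l1, l2, l3⟩ := workUpdate_le w r y₃ a b
    obtain ⟨m1, m2, m3⟩ := workUpdate_le w r y₁ y₂ x
    rcases workUpdate_cases w r x a b with e | e | e <;>
    rcases workUpdate_cases w r y₁ y₂ y₃ with e' | e' | e'
    · left; linarith
    · right; left; linarith
    · right; right; linarith
    · rcases h.exch₂' r x b y₂ y₃ with f | f
      · right; left; linarith
      · right; right; linarith
    · rcases h.exch₂' r x b y₁ y₃ with f | f
      · left; linarith
      · right; right; linarith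
    · rcases h.exch₂' r x b y₁ y₂ with f | f
      · left; linarith
      · right; left; linarith
    · rcases h.exch₂' r x a y₂ y₃ with f | f
      · right; left; linarith
      · right; right; linarith
    · rcases h.exch₂' r x a y₁ y₃ with f | f
      · left; linarith
      · right; right; linarith
    · rcases h.exch₂' r x a y₁ y₂ with f | f
      · left; linarith
      · right; left; linarith

theorem le_add_confDist (h : IsWorkLike w) (X Y : Fin 3 → Ω) :
    w (Y 0) (Y 1) (Y 2) ≤ w (X 0) (X 1) (X 2) + confDist X Y := by
  have l := h.lip_all (Y 0) (Y 1) (Y 2)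
  have s := h.swap₁₂
  have t := h.swap₂₃
  obtain ⟨σ, hσ⟩ := exists_confDist_eq Y X
  rw [confDist_comm, hσ, Fin.sum_univ_three]
  rcases perm_fin_three_cases σ with e | e | e | e | e | e <;>
    obtain ⟨e0, e1, e2⟩ := e <;> rw [e0, e1, e2]
  · exact l ..
  · rw [t (X 0)]; exact l ..
  · rw [s (X 0)]; exact l ..
  · rw [s (X 0), t (X 1)]; exact l ..
  · rw [t (X 0), s (X 0)]; exact l ..
  · rw [t (X 0), s (X 0), t (X 2)]; exact l ..

end IsWorkLike

end workUpdate

/-- The `3`-server work function after `t` requests, computed recursively, as a function of the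
three positions. -/
noncomputable def work {Ω : Type*} [MetricSpace Ω] (X₀ : Fin 3 → Ω) (r : ℕ → Ω) :
    ℕ → Ω → Ω → Ω → ℝ
  | 0 => assignCost (dist (X₀ 0)) (dist (X₀ 1)) (dist (X₀ 2))
  | t + 1 => workUpdate (work X₀ r t) (r (t + 1))

section work

variable {Ω : Type*} [MetricSpace Ω] (X₀ : Fin 3 → Ω) (r : ℕ → Ω)

theorem isWorkLike_work (t : ℕ) : IsWorkLike (work X₀ r t) := by
  induction t with
  | zero => exact isWorkLike_assignCost ..
  | succ t ih => exact ih.workUpdate _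

theorem work_zero (X : Fin 3 → Ω) : work X₀ r 0 (X 0) (X 1) (X 2) = confDist X₀ X :=
  (confDist_eq_assignCost X₀ X).symm

theorem exists_work_succ_eq (t : ℕ) (X : Fin 3 → Ω) :
    ∃ Z : Fin 3 → Ω, (∃ j, Z j = r (t + 1)) ∧
      work X₀ r t (Z 0) (Z 1) (Z 2) + confDist Z X ≤ work X₀ r (t + 1) (X 0) (X 1) (X 2) := by
  have h := isWorkLike_work X₀ r t
  have c := fun i => confDist_update_le X i (r (t + 1))
  rcases workUpdate_cases (work X₀ r t) (r (t + 1)) (X 0) (X 1) (X 2) with e | e | e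
  · refine ⟨Function.update X 0 (r (t + 1)), ⟨0, by simp⟩, ?_⟩
    rw [work, e]
    simpa using c 0
  · refine ⟨Function.update X 1 (r (t + 1)), ⟨1, by simp⟩, ?_⟩
    rw [work, e, h.swap₁₂ (r (t + 1))]
    simpa using c 1
  · refine ⟨Function.update X 2 (r (t + 1)), ⟨2, by simp⟩, ?_⟩
    rw [work, e, h.swap₁₂ (r (t + 1)), h.swap₂₃ (X 0)]
    simpa using c 2

theorem work_succ_le {t : ℕ} {Z : Fin 3 → Ω} (hZ : ∃ j, Z j = r (t + 1)) :
    work X₀ r (t + 1) (Z 0) (Z 1) (Z 2) ≤ work X₀ r t (Z 0) (Z 1) (Z 2) := by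
  have h := isWorkLike_work X₀ r t
  have h' := isWorkLike_work X₀ r (t + 1)
  obtain ⟨j, hj⟩ := hZ
  have key := workUpdate_self_le (work X₀ r t) (r (t + 1))
  fin_cases j <;> simp only [Fin.zero_eta, Fin.mk_one, Fin.reduceFinMk] at hj <;> rw [hj]
  · exact key ..
  · rw [h'.swap₁₂, h.swap₁₂ (Z 0)]; exact key ..
  · rw [h'.swap₂₃, h'.swap₁₂, h.swap₂₃, h.swap₁₂]; exact key ..

theorem work_le_succ (t : ℕ) (Z : Fin 3 → Ω) :
    work X₀ r t (Z 0) (Z 1) (Z 2) ≤ work X₀ r (t + 1) (Z 0) (Z 1) (Z 2) :=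
  (isWorkLike_work X₀ r t).le_workUpdate ..

theorem work_le_cost (t : ℕ) (Y : ℕ → Fin 3 → Ω) (h0 : Y 0 = X₀)
    (hY : ∀ i ∈ Icc 1 t, ∃ j, Y i j = r i) :
    work X₀ r t (Y t 0) (Y t 1) (Y t 2) ≤ ∑ i ∈ Icc 1 t, confDist (Y (i - 1)) (Y i) := by
  induction t with
  | zero => simp [work_zero, h0, confDist_self]
  | succ t ih =>
    rw [sum_Icc_succ_top (by simp), Nat.add_sub_cancel]
    have h1 := ih fun i hi => hY i (Icc_subset_Icc_right (Nat.le_succ t) hi)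
    have h2 := work_succ_le X₀ r (hY (t + 1) (by simp))
    have h3 := (isWorkLike_work X₀ r t).le_add_confDist (Y t) (Y (t + 1))
    linarith

theorem exists_schedule_extend {t : ℕ} {Y : ℕ → Fin 3 → Ω} (h0 : Y 0 = X₀)
    (hY : ∀ i ∈ Icc 1 t, ∃ j, Y i j = r i) {Z : Fin 3 → Ω} (hZ : ∃ j, Z j = r (t + 1)) :
    ∃ Y' : ℕ → Fin 3 → Ω, Y' 0 = X₀ ∧ (∀ i ∈ Icc 1 (t + 1), ∃ j, Y' i j = r i) ∧
      Y' (t + 1) = Z ∧ ∑ i ∈ Icc 1 (t + 1), confDist (Y' (i - 1)) (Y' i) =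
        ∑ i ∈ Icc 1 t, confDist (Y (i - 1)) (Y i) + confDist (Y t) Z := by
  have hne {i : ℕ} (hi : i ≤ t) : Function.update Y (t + 1) Z i = Y i :=
    Function.update_of_ne (by lia) _ _
  refine ⟨Function.update Y (t + 1) Z, by rw [hne (by lia), h0], fun i hi => ?_, by simp, ?_⟩
  · rcases (mem_Icc.1 hi).2.lt_or_eq with h | rfl
    · rw [hne (by lia)]
      exact hY i (mem_Icc.2 ⟨(mem_Icc.1 hi).1, by lia⟩)
    · simpa using hZ
  · rw [sum_Icc_succ_top (by simp), Nat.add_sub_cancel, hne le_rfl, Function.update_self]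
    congr 1
    refine sum_congr rfl fun i hi => ?_
    rw [mem_Icc] at hi
    rw [hne (by lia), hne (by lia)]

theorem exists_schedule (t : ℕ) (X : Fin 3 → Ω) :
    ∃ Y : ℕ → Fin 3 → Ω, Y 0 = X₀ ∧ (∀ i ∈ Icc 1 t, ∃ j, Y i j = r i) ∧
      ∑ i ∈ Icc 1 t, confDist (Y (i - 1)) (Y i) + confDist (Y t) X ≤
        work X₀ r t (X 0) (X 1) (X 2) := by
  induction t generalizing X with
  | zero => exact ⟨fun _ => X₀, rfl, by simp, by simp [work_zero]⟩
  | succ t ih =>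
    obtain ⟨Z, hZ, hZX⟩ := exists_work_succ_eq X₀ r t X
    obtain ⟨Y, h0, hY, hc⟩ := ih Z
    obtain ⟨Y', h0', hY', hend, hsum⟩ := exists_schedule_extend X₀ r h0 hY hZ
    refine ⟨Y', h0', hY', ?_⟩
    rw [hsum, hend]
    linarith

theorem optTo_succ_eq_work {t : ℕ} {Z : Fin 3 → Ω} (hZ : ∃ j, Z j = r (t + 1)) :
    optTo 3 X₀ r (t + 1) Z = work X₀ r (t + 1) (Z 0) (Z 1) (Z 2) := by
  obtain ⟨Y, h0, hY, hc⟩ := exists_schedule X₀ r t Z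
  obtain ⟨Y', h0', hY', hend, hsum⟩ := exists_schedule_extend X₀ r h0 hY hZ
  apply le_antisymm
  · have hle : optTo 3 X₀ r (t + 1) Z ≤ ∑ i ∈ Icc 1 (t + 1), confDist (Y' (i - 1)) (Y' i) := by
      refine csInf_le ⟨0, ?_⟩ ⟨Y', h0', hY', hend, rfl⟩
      rintro c ⟨Y, -, -, -, rfl⟩
      exact sum_nonneg fun _ _ => confDist_nonneg ..
    rw [hsum] at hle
    exact hle.trans (hc.trans (work_le_succ X₀ r t Z))
  · refine le_csInf ⟨_, Y', h0', hY', hend, rfl⟩ ?_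
    rintro c ⟨Y, h0, hY, rfl, rfl⟩
    exact work_le_cost X₀ r (t + 1) Y h0 hY

theorem IsWFARun.confDist_add_work_le {X₀ : Fin 3 → Ω} {r : ℕ → Ω} {T : ℕ}
    {X : ℕ → Fin 3 → Ω} (hX : IsWFARun 3 X₀ r T X) {t : ℕ} (ht : t < T) :
    confDist (X t) (X (t + 1)) + work X₀ r (t + 1) (X (t + 1) 0) (X (t + 1) 1) (X (t + 1) 2) ≤
      work X₀ r (t + 1) (X t 0) (X t 1) (X t 2) := by
  obtain ⟨hreq, hmin⟩ := hX.2 (t + 1) (by lia) ht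
  obtain ⟨Z, hZ, hZX⟩ := exists_work_succ_eq X₀ r t (X t)
  have h := hmin Z hZ
  rw [optTo_succ_eq_work X₀ r hreq, optTo_succ_eq_work X₀ r hZ, Nat.add_sub_cancel,
    confDist_comm] at h
  linarith [work_succ_le X₀ r hZ]

end work

section circle

variable {Δ : ℝ}

theorem AddCircle.dist_coe_coe_eq (hΔ : 0 < Δ) {x y : ℝ} (h : |x - y| ≤ Δ) :
    dist (x : AddCircle (2 * Δ)) (y : AddCircle (2 * Δ)) = |x - y| := by
  rw [dist_eq_norm, ← AddCircle.coe_sub, AddCircle.norm_coe_eq_abs_iff _ (by positivity),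
    abs_of_pos (by positivity : 0 < 2 * Δ)]
  linarith

theorem AddCircle.dist_le_half (hΔ : 0 < Δ) (x y : AddCircle (2 * Δ)) : dist x y ≤ Δ := by
  rw [dist_eq_norm]
  refine (AddCircle.norm_le_half_period (2 * Δ) (by positivity)).trans ?_
  rw [abs_of_pos (by positivity)]
  linarith

theorem AddCircle.dist_coe_coe_le (hΔ : 0 < Δ) (x y : ℝ) :
    dist (x : AddCircle (2 * Δ)) (y : AddCircle (2 * Δ)) ≤ |x - y| := by
  rcases le_total |x - y| Δ with h | h
  · exact (AddCircle.dist_coe_coe_eq hΔ h).le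
  · exact (AddCircle.dist_le_half hΔ _ _).trans h

theorem AddCircle.dist_add_dist_antipode_le (hΔ : 0 < Δ) (x : AddCircle (2 * Δ)) (y : ℝ) :
    dist x y + dist x (y + Δ : ℝ) ≤ Δ := by
  have : Fact (0 < 2 * Δ) := ⟨by positivity⟩
  obtain ⟨⟨z, hz1, hz2⟩, rfl⟩ := (AddCircle.equivIco (2 * Δ) (y - Δ)).symm.surjective x
  change dist (z : AddCircle (2 * Δ)) y + dist (z : AddCircle (2 * Δ)) (y + Δ : ℝ) ≤ Δ
  have h1 := AddCircle.dist_coe_coe_le hΔ z y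
  rcases le_total y z with h | h
  · have h2 := AddCircle.dist_coe_coe_le hΔ z (y + Δ)
    rw [abs_of_nonneg (by linarith)] at h1
    rw [abs_of_nonpos (by linarith)] at h2
    linarith
  · have h2 := AddCircle.dist_coe_coe_le hΔ z (y - Δ)
    have e : ((y + Δ : ℝ) : AddCircle (2 * Δ)) = (y - Δ : ℝ) := by
      rw [← AddCircle.coe_add_period (2 * Δ) (y - Δ)]
      congr 1
      ring
    rw [abs_of_nonpos (by linarith)] at h1
    rw [abs_of_nonneg (by linarith)] at h2
    rw [e]
    linarith

variable {w : AddCircle (2 * Δ) → AddCircle (2 * Δ) → AddCircle (2 * Δ) → ℝ}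

/-- `M` is a lower bound for the hexagon potential of the work function `w`. -/
def IsPotentialBound (w : AddCircle (2 * Δ) → AddCircle (2 * Δ) → AddCircle (2 * Δ) → ℝ)
    (M : ℝ) : Prop :=
  ∀ q a b c : ℝ, a ≤ b → b ≤ c → c ≤ a + Δ →
    M ≤ w ↑(q + Δ) ↑(q + Δ) ↑(q + Δ) + hexagonSum Δ (fun x y z => w ↑x ↑y ↑z) q a b c

theorem IsWorkLike.isPeriodicWork_workUpdate (hΔ : 0 < Δ) (h : IsWorkLike w) (s : ℝ) :
    IsPeriodicWork Δ fun x y z => _root_.workUpdate w s ↑(s + x) ↑(s + y) ↑(s + z) where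
  swap₁₂ _ _ _ := (h.workUpdate s).swap₁₂ ..
  swap₂₃ _ _ _ := (h.workUpdate s).swap₂₃ ..
  lip x x' y z := by
    have := AddCircle.dist_coe_coe_le hΔ (s + x) (s + x')
    rw [add_sub_add_left_eq_sub] at this
    exact ((h.workUpdate s).lip ..).trans (add_le_add_right this _)
  periodic x y z := by rw [← add_assoc, AddCircle.coe_add_period]
  exch _ _ _ _ _ := (h.workUpdate s).exch₂ ..
  supp x y z hx hy hz := by
    have hd {t : ℝ} (ht : |t| ≤ Δ) : dist ((s + t : ℝ) : AddCircle (2 * Δ)) s = |t| := by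
      rw [AddCircle.dist_coe_coe_eq hΔ] <;> rw [add_sub_cancel_left]
      exact ht
    have u := workUpdate_self_le w s
    rw [add_zero, ← hd hx, ← hd hy, ← hd hz]
    rcases workUpdate_cases w s (s + x : ℝ) (s + y : ℝ) (s + z : ℝ) with e | e | e
    · left; linarith [u (s + y : ℝ) (s + z : ℝ)]
    · right; left; linarith [u (s + x : ℝ) (s + z : ℝ)]
    · right; right; linarith [u (s + x : ℝ) (s + y : ℝ)]

theorem hexagonSum_translate (W : ℝ → ℝ → ℝ → ℝ) (s q a b c : ℝ) :
    hexagonSum Δ (fun x y z => W (s + x) (s + y) (s + z)) q a b c =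
      hexagonSum Δ W (s + q) (s + a) (s + b) (s + c) := by
  simp only [hexagonSum, add_assoc]

theorem hexagonSum_mono {W W' : ℝ → ℝ → ℝ → ℝ} (h : ∀ x y z, W x y z ≤ W' x y z)
    (q a b c : ℝ) : hexagonSum Δ W q a b c ≤ hexagonSum Δ W' q a b c :=
  add_le_add (add_le_add (h ..) (h ..)) (h ..)

/-- A request at `s` raises the potential by at least the increase of the work function at the
configuration with all servers at the antipode of `s`. -/
theorem IsPotentialBound.workUpdate (hΔ : 0 < Δ) (h : IsWorkLike w) {M : ℝ}
    (hM : IsPotentialBound w M) (s : ℝ) :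
    IsPotentialBound (workUpdate w s) (M + (workUpdate w s ↑(s + Δ) ↑(s + Δ) ↑(s + Δ) -
      w ↑(s + Δ) ↑(s + Δ) ↑(s + Δ))) := by
  intro q a b c hab hbc hc
  have hW := h.isPeriodicWork_workUpdate hΔ s
  have key := hW.hexagon_le hΔ (M := M - w ↑(s + Δ) ↑(s + Δ) ↑(s + Δ)) ?_ (q - s) (a - s) (b - s)
    (c - s) (by linarith) (by linarith) (by linarith)
  · rw [hexagonSum_translate fun x y z => _root_.workUpdate w s x y z] at key
    have e : s + (q - s + Δ) = q + Δ := by ring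
    simp only [add_sub_cancel, add_zero, e] at key
    have l := (h.workUpdate s).lip (s + Δ : ℝ) s (s + Δ : ℝ) (s + Δ : ℝ)
    have d := AddCircle.dist_le_half hΔ ((s + Δ : ℝ) : AddCircle (2 * Δ)) s
    linarith
  · intro a b c hab hbc hc
    rw [hexagonSum_translate fun x y z => _root_.workUpdate w s x y z, add_zero]
    have h1 := hM s (s + a) (s + b) (s + c) (by linarith) (by linarith) (by linarith)
    have h2 := hexagonSum_mono (Δ := Δ) (W := fun x y z => w x y z)
      (W' := fun x y z => _root_.workUpdate w s x y z) (fun x y z => h.le_workUpdate _ _ _ _)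
      s (s + a) (s + b) (s + c)
    linarith

/-- The increase of the work function caused by a request at `s` is largest at the configuration
with all servers at the antipode of `s`. -/
theorem IsWorkLike.workUpdate_sub_le (hΔ : 0 < Δ) (h : IsWorkLike w) (s : ℝ)
    (x y z : AddCircle (2 * Δ)) :
    _root_.workUpdate w s x y z - w x y z ≤
      _root_.workUpdate w s ↑(s + Δ) ↑(s + Δ) ↑(s + Δ) - w ↑(s + Δ) ↑(s + Δ) ↑(s + Δ) := by
  set p : AddCircle (2 * Δ) := ((s + Δ : ℝ) : AddCircle (2 * Δ)) with hp
  have hd : dist p s = Δ := by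
    rw [hp, AddCircle.dist_coe_coe_eq hΔ] <;> rw [add_sub_cancel_left, abs_of_pos hΔ]
  have ha := AddCircle.dist_add_dist_antipode_le hΔ
  obtain ⟨u1, u2, u3⟩ := workUpdate_le w s x y z
  have hup : w s p p + Δ ≤ _root_.workUpdate w s p p p := by
    rcases workUpdate_cases w s p p p with e | e | e <;> rw [e, hd]
  have l (t : AddCircle (2 * Δ)) : w p p p ≤ w t p p + dist t p := by
    rw [dist_comm]; exact h.lip ..
  rcases h.exch₃ s p p x y z with e | e | e
  · linarith [ha x s, l x]
  · linarith [ha y s, l y, h.swap₁₂ x s z]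
  · linarith [ha z s, l z, h.swap₂₃ x y s, h.swap₁₂ x s y]

end circle

/-- The work function algorithm is `3`-competitive for the `3`-server problem on
the circle of circumference `2Δ`. -/
theorem wfa_is_three_competitive_on_circle (Δ : ℝ) (hΔ : 0 < Δ)
    (X₀ : Fin 3 → AddCircle (2*Δ)) :
    ∃ c : ℝ, ∀ (T : ℕ) (r : ℕ → AddCircle (2*Δ)) (X : ℕ → Fin 3 → AddCircle (2*Δ)),
      IsWFARun 3 X₀ r T X →
      ∑ t ∈ Finset.Icc 1 T, confDist (X (t - 1)) (X t) ≤ 3 * opt 3 X₀ r T + c := by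
  refine ⟨21 * Δ, fun T r X hX => ?_⟩
  have hw (t : ℕ) := isWorkLike_work X₀ r t
  have hdist := AddCircle.dist_le_half hΔ
  have potential (t : ℕ) (ht : t ≤ T) : IsPotentialBound (work X₀ r t)
      (∑ i ∈ Icc 1 t, confDist (X (i - 1)) (X i) +
        work X₀ r t (X t 0) (X t 1) (X t 2)) := by
    induction t with
    | zero =>
      have nonneg (x y z : AddCircle (2 * Δ)) : 0 ≤ work X₀ r 0 x y z :=
        (confDist_nonneg X₀ ![x, y, z]).trans_eq (work_zero X₀ r ![x, y, z]).symm
      intro q a b c _ _ _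
      rw [work_zero, hX.1, confDist_self]
      simp only [Icc_eq_empty_of_lt zero_lt_one, sum_empty, add_zero]
      exact add_nonneg (nonneg ..) (add_nonneg (add_nonneg (nonneg ..) (nonneg ..)) (nonneg ..))
    | succ t ih =>
      obtain ⟨s, hs⟩ := QuotientAddGroup.mk_surjective (r (t + 1))
      have step := (ih (by lia)).workUpdate hΔ (hw t) s
      have dual := (hw t).workUpdate_sub_le hΔ s (X t 0) (X t 1) (X t 2)
      have move := hX.confDist_add_work_le (t := t) (by lia)
      intro q a b c hab hbc hc
      have bound := step q a b c hab hbc hc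
      have hsucc : work X₀ r (t + 1) = workUpdate (work X₀ r t) s := by
        rw [work, ← hs]
      rw [sum_Icc_succ_top (by simp), Nat.add_sub_cancel, hsucc]
      rw [hsucc] at move
      linarith
  have final := potential T le_rfl 0 0 0 0 le_rfl le_rfl (by linarith)
  have near (x y z : AddCircle (2 * Δ)) (Z : Fin 3 → AddCircle (2 * Δ)) :
      work X₀ r T x y z ≤ work X₀ r T (Z 0) (Z 1) (Z 2) + 3 * Δ := by
    linarith [(hw T).lip_all x y z (Z 0) (Z 1) (Z 2), hdist x (Z 0), hdist y (Z 1), hdist z (Z 2)]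
  obtain ⟨Y, h0, hY, -⟩ := exists_schedule X₀ r T X₀
  suffices (∑ t ∈ Icc 1 T, confDist (X (t - 1)) (X t) - 21 * Δ) / 3 ≤ opt 3 X₀ r T by linarith
  refine le_csInf ⟨_, Y, h0, hY, rfl⟩ ?_
  rintro c ⟨Y, h0, hY, rfl⟩
  have cost := work_le_cost X₀ r T Y h0 hY
  have close := near (X T 0) (X T 1) (X T 2) (Y T)
  unfold hexagonSum at final
  linarith [near ↑(0 + Δ) ↑(0 + Δ) ↑(0 + Δ) (X T), near ↑(0 : ℝ) ↑(0 : ℝ) ↑(0 : ℝ) (X T),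
    near ↑(0 : ℝ) ↑(0 : ℝ) ↑(0 + Δ) (X T), near ↑(0 : ℝ) ↑(0 + Δ) ↑(0 + Δ) (X T)]
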